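/- Let X₁ and X₂ be independent real random variables with X₁ distributed as the real Gaussian measure with mean μ₁ and variance σ₁², and X₂ distributed as the real Gaussian measure with mean μ₂ and variance σ₂², where σ₁² + σ₂² > 0. Set ν = √(σ₁² + σ₂²) and γ = (μ₁ − μ₂)/ν, and let Z = max(X₁, X₂). Then E[Z²] = (μ₁² + σ₁²)·Φ(γ) + (μ₂² + σ₂²)·Φ(−γ) + (μ₁ + μ₂)·ν·φ(γ), where Φ is the cumulative distribution function and φ the probability density function of the standard Gaussian distribution. -/

import Mathlib

open MeasureTheory ProbabilityTheory
open scoped NNReal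

/-- Standard normal probability density function `φ`. -/
noncomputable def stdNormalPDF (t : ℝ) : ℝ :=
  Real.exp (-t ^ 2 / 2) / Real.sqrt (2 * Real.pi)

/-- Standard normal cumulative distribution function `Φ(t) = ∫_{-∞}^t φ(s) ds`. -/
noncomputable def stdNormalCDF (t : ℝ) : ℝ :=
  ∫ s in Set.Iic t, stdNormalPDF s

lemma stdNormalPDF_eq_gaussianPDFReal : stdNormalPDF = gaussianPDFReal 0 1 := by
  ext t
  simp [stdNormalPDF, gaussianPDFReal, div_eq_inv_mul]

lemma integrable_stdNormalPDF : Integrable stdNormalPDF :=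
  stdNormalPDF_eq_gaussianPDFReal ▸ integrable_gaussianPDFReal 0 1

lemma integrable_mul_stdNormalPDF : Integrable fun t ↦ t * stdNormalPDF t := by
  refine ((integrable_mul_exp_neg_mul_sq (b := 1 / 2) (by norm_num)).div_const
    √(2 * Real.pi)).congr (.of_forall fun t ↦ ?_)
  simp only [stdNormalPDF]
  ring_nf

lemma integrable_sq_mul_stdNormalPDF : Integrable fun t ↦ t ^ 2 * stdNormalPDF t := by
  refine ((integrable_rpow_mul_exp_neg_mul_sq (b := 1 / 2) (s := 2) (by norm_num)
    (by norm_num)).div_const √(2 * Real.pi)).congr (.of_forall fun t ↦ ?_)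
  simp only [stdNormalPDF, Real.rpow_two]
  ring_nf

lemma hasDerivAt_stdNormalPDF (t : ℝ) : HasDerivAt stdNormalPDF (-(t * stdNormalPDF t)) t := by
  have h := (((hasDerivAt_pow 2 t).neg.div_const 2).exp).div_const √(2 * Real.pi)
  refine h.congr_deriv ?_
  simp [stdNormalPDF]
  ring

lemma hasDerivAt_mul_stdNormalPDF (t : ℝ) :
    HasDerivAt (fun t ↦ t * stdNormalPDF t) (stdNormalPDF t - t ^ 2 * stdNormalPDF t) t := by
  refine ((hasDerivAt_id t).mul (hasDerivAt_stdNormalPDF t)).congr_deriv ?_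
  simp only [id]
  ring

lemma setIntegral_Iic_eq_of_hasDerivAt_of_integrable {f f' : ℝ → ℝ}
    (hderiv : ∀ x, HasDerivAt f (f' x) x) (hf' : Integrable f') (hf : Integrable f) (a : ℝ) :
    ∫ x in Set.Iic a, f' x = f a := by
  have hlim := tendsto_zero_of_hasDerivAt_of_integrableOn_Iic (a := a) (fun x _ ↦ hderiv x)
    hf'.integrableOn hf.integrableOn
  simpa using integral_Iic_of_hasDerivAt_of_tendsto' (fun x _ ↦ hderiv x) hf'.integrableOn hlim

lemma setIntegral_Iic_mul_stdNormalPDF (a : ℝ) :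
    ∫ t in Set.Iic a, t * stdNormalPDF t = -stdNormalPDF a := by
  rw [← setIntegral_Iic_eq_of_hasDerivAt_of_integrable hasDerivAt_stdNormalPDF
    integrable_mul_stdNormalPDF.neg integrable_stdNormalPDF a, integral_neg, neg_neg]

lemma setIntegral_Iic_sq_mul_stdNormalPDF (a : ℝ) :
    ∫ t in Set.Iic a, t ^ 2 * stdNormalPDF t = stdNormalCDF a - a * stdNormalPDF a := by
  have h := setIntegral_Iic_eq_of_hasDerivAt_of_integrable hasDerivAt_mul_stdNormalPDF
    (integrable_stdNormalPDF.sub integrable_sq_mul_stdNormalPDF) integrable_mul_stdNormalPDF a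
  rw [integral_sub integrable_stdNormalPDF.integrableOn
    integrable_sq_mul_stdNormalPDF.integrableOn] at h
  rw [stdNormalCDF]
  linarith

lemma stdNormalCDF_neg (t : ℝ) : stdNormalCDF (-t) = 1 - stdNormalCDF t := by
  have h := integral_comp_neg_Iic (-t) stdNormalPDF
  have he : (fun x ↦ stdNormalPDF (-x)) = stdNormalPDF := by
    ext x
    simp [stdNormalPDF]
  rw [neg_neg] at h
  simp only [he] at h
  have hadd := integral_add_compl (measurableSet_Iic (a := t)) integrable_stdNormalPDF
  rw [Set.compl_Iic, stdNormalPDF_eq_gaussianPDFReal,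
    integral_gaussianPDFReal_eq_one 0 one_ne_zero, ← stdNormalPDF_eq_gaussianPDFReal, ← h] at hadd
  simp only [stdNormalCDF]
  linarith

lemma gaussianReal_eq_map_const_sub_mul (m c : ℝ) (v : ℝ≥0) (hv : (v : ℝ) = c ^ 2) :
    gaussianReal m v = (gaussianReal 0 1).map fun t ↦ m - c * t := by
  have h := gaussianReal_const_sub (gaussianReal_const_mul (HasLaw.id (μ := gaussianReal 0 1)) c) m
  have hv' : v = .mk (c ^ 2) (sq_nonneg c) := NNReal.eq hv
  simpa [hv'] using h.map_eq.symm

lemma integral_comp_posPart_gaussianReal (m : ℝ) {c : ℝ} (hc : 0 < c) (v : ℝ≥0)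
    (hv : (v : ℝ) = c ^ 2) {g : ℝ → ℝ} (hg : Measurable g) (hg0 : g 0 = 0) :
    ∫ x, g (max x 0) ∂gaussianReal m v =
      ∫ t in Set.Iic (m / c), g (m - c * t) * stdNormalPDF t := by
  rw [gaussianReal_eq_map_const_sub_mul m c v hv, integral_map (by fun_prop)
    (by fun_prop : Measurable fun x ↦ g (max x 0)).aestronglyMeasurable,
    integral_gaussianReal_eq_integral_smul one_ne_zero, ← integral_indicator measurableSet_Iic]
  congr 1 with t
  rw [← stdNormalPDF_eq_gaussianPDFReal]
  by_cases ht : t ∈ Set.Iic (m / c)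
  · have hle := (le_div_iff₀' hc).1 ht
    rw [Set.indicator_of_mem ht, max_eq_left (by linarith), smul_eq_mul, mul_comm]
  · have hlt := (div_lt_iff₀' hc).1 (not_le.1 ht)
    rw [Set.indicator_of_notMem ht, max_eq_right (by linarith), hg0, smul_zero]

lemma integral_posPart_gaussianReal (m : ℝ) {c : ℝ} (hc : 0 < c) (v : ℝ≥0)
    (hv : (v : ℝ) = c ^ 2) :
    ∫ x, max x 0 ∂gaussianReal m v = m * stdNormalCDF (m / c) + c * stdNormalPDF (m / c) := by
  rw [integral_comp_posPart_gaussianReal m hc v hv (g := fun x ↦ x) measurable_id rfl]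
  simp_rw [sub_mul, mul_assoc]
  rw [integral_sub (integrable_stdNormalPDF.const_mul _).integrableOn
    (integrable_mul_stdNormalPDF.const_mul _).integrableOn, integral_const_mul,
    integral_const_mul, setIntegral_Iic_mul_stdNormalPDF, ← stdNormalCDF]
  ring

lemma integral_posPart_sq_gaussianReal (m : ℝ) {c : ℝ} (hc : 0 < c) (v : ℝ≥0)
    (hv : (v : ℝ) = c ^ 2) :
    ∫ x, max x 0 ^ 2 ∂gaussianReal m v =
      (m ^ 2 + c ^ 2) * stdNormalCDF (m / c) + m * c * stdNormalPDF (m / c) := by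
  rw [integral_comp_posPart_gaussianReal m hc v hv (g := fun x ↦ x ^ 2) (by fun_prop) (by simp)]
  have he (t : ℝ) : (m - c * t) ^ 2 * stdNormalPDF t = m ^ 2 * stdNormalPDF t
      - 2 * m * c * (t * stdNormalPDF t) + c ^ 2 * (t ^ 2 * stdNormalPDF t) := by ring
  simp_rw [he]
  have h0 := (integrable_stdNormalPDF.const_mul (m ^ 2)).integrableOn (s := Set.Iic (m / c))
  have h1 := (integrable_mul_stdNormalPDF.const_mul (2 * m * c)).integrableOn
    (s := Set.Iic (m / c))
  have h2 := (integrable_sq_mul_stdNormalPDF.const_mul (c ^ 2)).integrableOn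
    (s := Set.Iic (m / c))
  have h01 : IntegrableOn (fun t ↦ m ^ 2 * stdNormalPDF t - 2 * m * c * (t * stdNormalPDF t))
    (Set.Iic (m / c)) := h0.sub h1
  rw [integral_add h01 h2, integral_sub h0 h1, integral_const_mul, integral_const_mul,
    integral_const_mul, setIntegral_Iic_mul_stdNormalPDF, setIntegral_Iic_sq_mul_stdNormalPDF,
    ← stdNormalCDF]
  field_simp
  ring

lemma max_sq_eq_add_posPart_sub_mul_add (a b : ℝ) :
    max a b ^ 2 = b ^ 2 + max (a - b) 0 * (a + b) := by
  rcases le_total a b with h | h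
  · rw [max_eq_right h, max_eq_right (by linarith)]
    ring
  · rw [max_eq_left h, max_eq_left (by linarith)]
    ring

/-- **Second moment of the max of two independent Gaussians**:
`E[max(X₁,X₂)²] = (μ₁²+σ₁²) Φ(γ) + (μ₂²+σ₂²) Φ(−γ) + (μ₁+μ₂) ν φ(γ)` with `ν = √(σ₁² + σ₂²)` and
`γ = (μ₁ − μ₂)/ν`. -/
theorem max_gaussian_second_moment {Ω : Type*} [MeasurableSpace Ω]
    (P : Measure Ω) [IsProbabilityMeasure P]
    (X₁ X₂ : Ω → ℝ) (hX₁ : Measurable X₁) (hX₂ : Measurable X₂)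
    (hind : IndepFun X₁ X₂ P)
    (μ₁ μ₂ : ℝ) (σ₁ σ₂ : ℝ≥0)
    (h₁ : Measure.map X₁ P = gaussianReal μ₁ (σ₁ ^ 2))
    (h₂ : Measure.map X₂ P = gaussianReal μ₂ (σ₂ ^ 2))
    (hσ : 0 < (σ₁ : ℝ) ^ 2 + (σ₂ : ℝ) ^ 2)
    (ν γ : ℝ)
    (hν : ν = Real.sqrt ((σ₁ : ℝ) ^ 2 + (σ₂ : ℝ) ^ 2))
    (hγ : γ = (μ₁ - μ₂) / ν) :
    ∫ ω, (max (X₁ ω) (X₂ ω)) ^ 2 ∂P =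
      (μ₁ ^ 2 + (σ₁ : ℝ) ^ 2) * stdNormalCDF γ + (μ₂ ^ 2 + (σ₂ : ℝ) ^ 2) * stdNormalCDF (-γ)
        + (μ₁ + μ₂) * ν * stdNormalPDF γ := by
  have hL₁ : HasLaw X₁ (gaussianReal μ₁ (σ₁ ^ 2)) P := ⟨hX₁.aemeasurable, h₁⟩
  have hL₂ : HasLaw X₂ (gaussianReal μ₂ (σ₂ ^ 2)) P := ⟨hX₂.aemeasurable, h₂⟩
  have hpair := IndepFun.hasGaussianLaw hL₁.hasGaussianLaw hL₂.hasGaussianLaw hind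
  have hm₁ : MemLp X₁ 2 P := hL₁.hasGaussianLaw.memLp_two
  have hm₂ : MemLp X₂ 2 P := hL₂.hasGaussianLaw.memLp_two
  have hE₁ : ∫ ω, X₁ ω ∂P = μ₁ := by rw [hL₁.integral_eq, integral_id_gaussianReal]
  have hE₂ : ∫ ω, X₂ ω ∂P = μ₂ := by rw [hL₂.integral_eq, integral_id_gaussianReal]
  have hV₁ : Var[X₁; P] = (σ₁ : ℝ) ^ 2 := by
    rw [hL₁.variance_eq, variance_id_gaussianReal, NNReal.coe_pow]
  have hV₂ : Var[X₂; P] = (σ₂ : ℝ) ^ 2 := by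
    rw [hL₂.variance_eq, variance_id_gaussianReal, NNReal.coe_pow]
  have hν0 : 0 < ν := hν ▸ Real.sqrt_pos.2 hσ
  have hν2 : ν ^ 2 = (σ₁ : ℝ) ^ 2 + (σ₂ : ℝ) ^ 2 := by rw [hν, Real.sq_sqrt hσ.le]
  -- The combination `W` is uncorrelated with, hence independent of, the difference `U`.
  let U : Ω → ℝ := X₁ - X₂
  let W : Ω → ℝ := (σ₂ : ℝ) ^ 2 • X₁ + (σ₁ : ℝ) ^ 2 • X₂
  have hcov : cov[U, W; P] = 0 := by
    simp only [U, W]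
    rw [covariance_sub_left hm₁ hm₂ ((hm₁.const_smul _).add (hm₂.const_smul _)),
      covariance_add_right hm₁ (hm₁.const_smul _) (hm₂.const_smul _),
      covariance_add_right hm₂ (hm₁.const_smul _) (hm₂.const_smul _)]
    simp only [covariance_smul_right]
    rw [covariance_comm X₂ X₁, hind.covariance_eq_zero hm₁ hm₂,
      covariance_self hX₁.aemeasurable, covariance_self hX₂.aemeasurable, hV₁, hV₂]
    ring
  have hUW : HasGaussianLaw (fun ω ↦ (U ω, W ω)) P :=
    hpair.map ((ContinuousLinearMap.fst ℝ ℝ ℝ - ContinuousLinearMap.snd ℝ ℝ ℝ).prod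
      ((σ₂ : ℝ) ^ 2 • ContinuousLinearMap.fst ℝ ℝ ℝ + (σ₁ : ℝ) ^ 2 • ContinuousLinearMap.snd ℝ ℝ ℝ))
  have hindUW : IndepFun U W P := hUW.indepFun_of_covariance_eq_zero hcov
  have hU : HasLaw U (gaussianReal (μ₁ - μ₂) (σ₁ ^ 2 + σ₂ ^ 2)) P := by
    refine ⟨(hX₁.sub hX₂).aemeasurable, ?_⟩
    have h := gaussianReal_add_gaussianReal_of_indepFun (hind.comp measurable_id measurable_neg)
      h₁ (gaussianReal_neg hL₂).map_eq
    have he : Neg.neg ∘ X₂ = -X₂ := rfl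
    simpa [U, sub_eq_add_neg, he] using h
  have hv : ((σ₁ ^ 2 + σ₂ ^ 2 : ℝ≥0) : ℝ) = ν ^ 2 := by rw [hν2]; push_cast; rfl
  have hEpos : ∫ ω, max (U ω) 0 ∂P = (μ₁ - μ₂) * stdNormalCDF γ + ν * stdNormalPDF γ := by
    rw [hγ, ← integral_posPart_gaussianReal _ hν0 _ hv]
    exact hU.integral_comp (f := fun x ↦ max x 0) (by fun_prop)
  have hEpos2 : ∫ ω, max (U ω) 0 ^ 2 ∂P =
      ((μ₁ - μ₂) ^ 2 + ν ^ 2) * stdNormalCDF γ + (μ₁ - μ₂) * ν * stdNormalPDF γ := by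
    rw [hγ, ← integral_posPart_sq_gaussianReal _ hν0 _ hv]
    exact hU.integral_comp (f := fun x ↦ max x 0 ^ 2) (by fun_prop)
  have hEW : ∫ ω, W ω ∂P = (σ₂ : ℝ) ^ 2 * μ₁ + (σ₁ : ℝ) ^ 2 * μ₂ := by
    have h := integral_add ((hm₁.integrable one_le_two).const_mul ((σ₂ : ℝ) ^ 2))
      ((hm₂.integrable one_le_two).const_mul ((σ₁ : ℝ) ^ 2))
    rwa [integral_const_mul, integral_const_mul, hE₁, hE₂] at h
  have hE₂2 : ∫ ω, X₂ ω ^ 2 ∂P = μ₂ ^ 2 + (σ₂ : ℝ) ^ 2 := by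
    have h := variance_eq_sub hm₂
    rw [hV₂, hE₂] at h
    simp only [Pi.pow_apply] at h
    linarith
  have hmpos : MemLp (fun ω ↦ max (U ω) 0) 2 P := hUW.fst.memLp_two.pos_part
  have hindpos : IndepFun (fun ω ↦ max (U ω) 0) W P :=
    hindUW.comp (φ := fun x ↦ max x 0) (by fun_prop) measurable_id
  have hEprod : ∫ ω, max (U ω) 0 * W ω ∂P = (∫ ω, max (U ω) 0 ∂P) * ∫ ω, W ω ∂P :=
    hindpos.integral_fun_mul_eq_mul_integral hmpos.aestronglyMeasurable
      hUW.snd.memLp_two.aestronglyMeasurable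
  have hdecomp (ω : Ω) : max (X₁ ω) (X₂ ω) ^ 2 = X₂ ω ^ 2
      + (2 / ν ^ 2 * (max (U ω) 0 * W ω)
        + ((σ₁ : ℝ) ^ 2 - (σ₂ : ℝ) ^ 2) / ν ^ 2 * max (U ω) 0 ^ 2) := by
    have hsq : max (U ω) 0 ^ 2 = max (U ω) 0 * U ω := by
      rcases le_total (U ω) 0 with h | h
      · simp [h]
      · rw [max_eq_left h, sq]
    have hsum : X₁ ω + X₂ ω =
        2 / ν ^ 2 * W ω + ((σ₁ : ℝ) ^ 2 - (σ₂ : ℝ) ^ 2) / ν ^ 2 * U ω := by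
      simp only [U, W, Pi.add_apply, Pi.sub_apply, Pi.smul_apply, smul_eq_mul]
      field_simp
      rw [hν2]
      ring
    rw [max_sq_eq_add_posPart_sub_mul_add, hsum, hsq]
    simp only [U, Pi.sub_apply]
    ring
  have hi1 : Integrable (fun ω ↦ 2 / ν ^ 2 * (max (U ω) 0 * W ω)) P :=
    (hmpos.integrable_mul hUW.snd.memLp_two).const_mul _
  have hi2 : Integrable
      (fun ω ↦ ((σ₁ : ℝ) ^ 2 - (σ₂ : ℝ) ^ 2) / ν ^ 2 * max (U ω) 0 ^ 2) P :=
    hmpos.integrable_sq.const_mul _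
  have hi12 : Integrable (fun ω ↦ 2 / ν ^ 2 * (max (U ω) 0 * W ω)
      + ((σ₁ : ℝ) ^ 2 - (σ₂ : ℝ) ^ 2) / ν ^ 2 * max (U ω) 0 ^ 2) P := hi1.add hi2
  simp_rw [hdecomp]
  rw [integral_add hm₂.integrable_sq hi12, integral_add hi1 hi2, integral_const_mul,
    integral_const_mul, hEprod, hEW, hEpos, hEpos2, hE₂2, stdNormalCDF_neg]
  have hσ₁ : (σ₁ : ℝ) ^ 2 = ν ^ 2 - (σ₂ : ℝ) ^ 2 := by linarith
  rw [hσ₁]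
  field_simp
  ring
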